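/- arXiv:1612.04085 — 2 statements merged into one kernel-verified Lean document; each statement's English description precedes it below -/
import Mathlib

section
/- Let m, n, d ≥ 1 be integers with m < n, and set α = ⌊md/(n−m)⌋ and s = md mod (n−m). Let G_rp denote the block-diagonal pencil (direct sum) consisting of s copies of L_{α+d} and n−m−s copies of L_{α+d−1}, a pencil of size (m+n(d−1)) × nd. Then the set {P ∈ POL_{d,m×n} : C¹_P is strictly equivalent to G_rp} is dense in POL_{d,m×n}; that is, its closure in the metric space POL_{d,m×n} equals all of POL_{d,m×n}. -/
open Matrix Finset

namespace MPoly

/-- The space `POL_{d,m×n}` of `m × n` complex matrix polynomials of grade `d`,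
identified with the tuple of coefficients `(A_0, …, A_d)`. -/
abbrev Pol (d m n : ℕ) := Fin (d+1) → Matrix (Fin m) (Fin n) ℂ

/-- A matrix pencil `λ A + B` of size `p × q`, identified with the pair `(A, B)`. -/
abbrev Pencil (p q : ℕ) := Matrix (Fin p) (Fin q) ℂ × Matrix (Fin p) (Fin q) ℂ

/-- The metric on `POL_{d,m×n}`:  `dist(P,P') = (Σ_i ‖A_i − A'_i‖_F²)^(1/2)`. -/
noncomputable def polDist {m n d : ℕ} (P P' : Pol d m n) : ℝ :=
  Real.sqrt (∑ k, ∑ i, ∑ j, ‖P k i j - P' k i j‖ ^ 2)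

/-- The Frobenius norm of a matrix polynomial: `‖P‖_F = (Σ_i ‖A_i‖_F²)^(1/2)`. -/
noncomputable def polNorm {m n d : ℕ} (P : Pol d m n) : ℝ :=
  Real.sqrt (∑ k, ∑ i, ∑ j, ‖P k i j‖ ^ 2)

/-- The metric on pencils: `dist(λA+B, λA'+B') = (‖A−A'‖_F² + ‖B−B'‖_F²)^(1/2)`. -/
noncomputable def penDist {p q : ℕ} (L L' : Pencil p q) : ℝ :=
  Real.sqrt ((∑ i, ∑ j, ‖L.1 i j - L'.1 i j‖ ^ 2) + (∑ i, ∑ j, ‖L.2 i j - L'.2 i j‖ ^ 2))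

/-- The `λ`-part `A = diag(A_d, I_n, …, I_n)` of the first companion form. -/
noncomputable def compA (m n d : ℕ) (P : Pol d m n) :
    Matrix (Fin (m + n*(d-1))) (Fin (n*d)) ℂ := fun i j =>
  if hi : (i : ℕ) < m then
    if hj : (j : ℕ) < n then P (Fin.last d) ⟨i, hi⟩ ⟨j, hj⟩ else 0
  else if (i : ℕ) - m = (j : ℕ) - n ∧ n ≤ (j : ℕ) then 1 else 0

/-- The constant part `B` of the first companion form: first block row
`(A_{d-1}, …, A_0)`, with `−I_n` in block entries `(i+1, i)`. -/
noncomputable def compB (m n d : ℕ) (P : Pol d m n) :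
    Matrix (Fin (m + n*(d-1))) (Fin (n*d)) ℂ := fun i j =>
  if hi : (i : ℕ) < m then
    if hn : 0 < n then
      P ⟨d - 1 - (j : ℕ) / n, Nat.lt_succ_of_le ((Nat.sub_le _ _).trans (Nat.sub_le d 1))⟩ ⟨i, hi⟩ ⟨(j : ℕ) % n, Nat.mod_lt _ hn⟩
    else 0
  else if (j : ℕ) = (i : ℕ) - m then -1 else 0

/-- The first Frobenius companion form `C¹_P` of a matrix polynomial. -/
noncomputable def comp (m n d : ℕ) (P : Pol d m n) : Pencil (m + n*(d-1)) (n*d) :=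
  (compA m n d P, compB m n d P)

/-- Strict equivalence of matrix pencils: `Q⁻¹ (λA+B) R = λC+D` for invertible `Q, R`. -/
def StrictEquiv {p q : ℕ} (L M : Pencil p q) : Prop :=
  ∃ (Q : Matrix (Fin p) (Fin p) ℂ) (R : Matrix (Fin q) (Fin q) ℂ),
    IsUnit Q ∧ IsUnit R ∧ Q⁻¹ * L.1 * R = M.1 ∧ Q⁻¹ * L.2 * R = M.2

/-- The strict equivalence orbit of a pencil. -/
def orbE {p q : ℕ} (L : Pencil p q) : Set (Pencil p q) := {M | StrictEquiv L M}

/-- The generalized Sylvester space `GSYL¹_{d,m×n}` of all first companion forms. -/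
def GSYL (m n d : ℕ) : Set (Pencil (m + n*(d-1)) (n*d)) := Set.range (comp m n d)

/-- A matrix polynomial viewed as a matrix over the field `ℂ(λ)` of rational functions. -/
noncomputable def ratMatrix {m n d : ℕ} (P : Pol d m n) :
    Matrix (Fin m) (Fin n) (RatFunc ℂ) :=
  fun i j => ∑ k : Fin (d+1), RatFunc.C (P k i j) * RatFunc.X ^ (k : ℕ)

/-- The normal rank of a matrix polynomial: its rank over `ℂ(λ)`. -/
noncomputable def nrank {m n d : ℕ} (P : Pol d m n) : ℕ := (ratMatrix P).rank

/-- Offset of the `b`-th diagonal block when block `j` has size `sz j`. -/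
def off (sz : ℕ → ℕ) (b : ℕ) : ℕ := ∑ j ∈ Finset.range b, sz j

/-- The `p × q` matrix given as a direct sum of `N` diagonal blocks, where block `b`
has size `ρ b × γ b` and entries `ent b`, blocks being laid out along the diagonal
in order (block `b` occupies rows `[off ρ b, off ρ b + ρ b)` and columns
`[off γ b, off γ b + γ b)`); all other entries are zero. -/
noncomputable def dsum (N : ℕ) (ρ γ : ℕ → ℕ) (ent : ℕ → ℕ → ℕ → ℂ) (p q : ℕ) :
    Matrix (Fin p) (Fin q) ℂ := fun x y =>
  ∑ b ∈ Finset.range N,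
    if off ρ b ≤ (x:ℕ) ∧ (x:ℕ) < off ρ b + ρ b ∧ off γ b ≤ (y:ℕ) ∧ (y:ℕ) < off γ b + γ b
    then ent b ((x:ℕ) - off ρ b) ((y:ℕ) - off γ b) else 0

/-- Sizes of the four sections of blocks: `c₁` blocks of size `v₁`, then `c₂` of size
`v₂`, then `c₃` of size `v₃`, then the rest of size `v₄`. -/
def secSize (c₁ c₂ c₃ : ℕ) (v₁ v₂ v₃ v₄ : ℕ) (i : ℕ) : ℕ :=
  if i < c₁ then v₁ else if i < c₁ + c₂ then v₂ else if i < c₁ + c₂ + c₃ then v₃ else v₄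

/-- The `p × q` pencil which is the direct sum of `c₁` copies of `L_{e₁}`, `c₂` copies
of `L_{e₂}`, `c₃` copies of `L_{f₁}ᵀ` and `c₄` copies of `L_{f₂}ᵀ`.  Here `L_k` is the
`k × (k+1)` pencil `λ G_k + F_k` with `G_k` having ones in entries `(i,i)` and `F_k`
having ones in entries `(i,i+1)`. -/
noncomputable def genPencil (c₁ c₂ c₃ c₄ e₁ e₂ f₁ f₂ p q : ℕ) : Pencil p q :=
  (dsum (c₁+c₂+c₃+c₄) (secSize c₁ c₂ c₃ e₁ e₂ (f₁+1) (f₂+1))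
     (secSize c₁ c₂ c₃ (e₁+1) (e₂+1) f₁ f₂)
     (fun _ i j => if i = j then 1 else 0) p q,
   dsum (c₁+c₂+c₃+c₄) (secSize c₁ c₂ c₃ e₁ e₂ (f₁+1) (f₂+1))
     (secSize c₁ c₂ c₃ (e₁+1) (e₂+1) f₁ f₂)
     (fun b i j => if b < c₁ + c₂ then (if j = i+1 then 1 else 0)
       else (if i = j+1 then 1 else 0)) p q)

/-- The generic pencil `G_a` of Theorem 3.2 (viewed at grade `d`):  the direct sum of
`s` copies of `L_{α+d}`, `n−r−s` copies of `L_{α+d−1}`, `t` copies of `L_{β+1}ᵀ` and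
`m−r−t` copies of `L_βᵀ`, where `α = ⌊a/(n−r)⌋`, `s = a mod (n−r)`,
`β = ⌊(rd−a)/(m−r)⌋`, `t = (rd−a) mod (m−r)`. -/
noncomputable def Ga (m n d r a : ℕ) : Pencil (m + n*(d-1)) (n*d) :=
  genPencil (a % (n-r)) (n-r - a % (n-r)) ((r*d - a) % (m-r)) (m-r - (r*d - a) % (m-r))
    (a/(n-r) + d) (a/(n-r) + d - 1) ((r*d - a)/(m-r) + 1) ((r*d - a)/(m-r))
    (m + n*(d-1)) (n*d)


/-- The generic rank-`ρ` pencil of size `p × q` with parameter `b` (Theorem 3.2 of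
De Terán–Dopico): direct sum of `s₁` copies of `L_{α₁+1}`, `q−ρ−s₁` copies of `L_{α₁}`,
`t₁` copies of `L_{β₁+1}ᵀ` and `p−ρ−t₁` copies of `L_{β₁}ᵀ`, where `α₁ = ⌊b/(q−ρ)⌋`,
`s₁ = b mod (q−ρ)`, `β₁ = ⌊(ρ−b)/(p−ρ)⌋`, `t₁ = (ρ−b) mod (p−ρ)`. -/
noncomputable def Kp (p q ρ b : ℕ) : Pencil p q :=
  genPencil (b % (q-ρ)) (q-ρ - b % (q-ρ)) ((ρ-b) % (p-ρ)) (p-ρ - (ρ-b) % (p-ρ))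
    (b/(q-ρ) + 1) (b/(q-ρ)) ((ρ-b)/(p-ρ) + 1) ((ρ-b)/(p-ρ)) p q

/-- The generic right-singular pencil `G_rp` (case `m < n`): direct sum of `s` copies of
`L_{α+d}` and `n−m−s` copies of `L_{α+d−1}`, with `α = ⌊md/(n−m)⌋`, `s = md mod (n−m)`. -/
noncomputable def Grp (m n d : ℕ) : Pencil (m + n*(d-1)) (n*d) :=
  genPencil (m*d % (n-m)) (n-m - m*d % (n-m)) 0 0
    (m*d/(n-m) + d) (m*d/(n-m) + d - 1) 0 0 (m + n*(d-1)) (n*d)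

/-- The generic left-singular pencil `G_ℓp` (case `m > n`): direct sum of `t` copies of
`L_{β+1}ᵀ` and `m−n−t` copies of `L_βᵀ`, with `β = ⌊nd/(m−n)⌋`, `t = nd mod (m−n)`. -/
noncomputable def Glp (m n d : ℕ) : Pencil (m + n*(d-1)) (n*d) :=
  genPencil 0 0 (n*d % (m-n)) (m-n - n*d % (m-n)) 0 0
    (n*d/(m-n) + 1) (n*d/(m-n)) (m + n*(d-1)) (n*d)

/-- The linear map `(X, Y) ↦ (XA − AY, XB − BY)` whose range is the tangent space at
`λA+B` to the strict equivalence orbit of the pencil `λA+B`. -/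
noncomputable def tangentMap {p q : ℕ} (L : Pencil p q) :
    (Matrix (Fin p) (Fin p) ℂ × Matrix (Fin q) (Fin q) ℂ) →ₗ[ℂ]
      (Matrix (Fin p) (Fin q) ℂ × Matrix (Fin p) (Fin q) ℂ) where
  toFun XY := (XY.1 * L.1 - L.1 * XY.2, XY.1 * L.2 - L.2 * XY.2)
  map_add' X Y := by
    obtain ⟨X₁, X₂⟩ := X; obtain ⟨Y₁, Y₂⟩ := Y
    simp only [Prod.mk_add_mk, Matrix.add_mul, Matrix.mul_add, Prod.mk.injEq]
    constructor <;> abel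
  map_smul' c X := by
    obtain ⟨X₁, X₂⟩ := X
    simp only [Prod.smul_mk, Matrix.smul_mul, Matrix.mul_smul, RingHom.id_apply,
      Prod.mk.injEq, smul_sub]

/-- The tangent space `T = {(XA − AY, XB − BY)}` at `λA+B` to its strict equivalence
orbit, as a subspace of the pencil space. -/
noncomputable def tangent {p q : ℕ} (L : Pencil p q) :
    Submodule ℂ (Matrix (Fin p) (Fin q) ℂ × Matrix (Fin p) (Fin q) ℂ) :=
  LinearMap.range (tangentMap L)

/-- The first companion form `C¹_M(λ) = λ A + B` regarded as a matrix over `ℂ[λ]`. -/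
noncomputable def compPoly (m n d : ℕ) (M : Pol d m n) :
    Matrix (Fin (m + n*(d-1))) (Fin (n*d)) (Polynomial ℂ) := fun i j =>
  Polynomial.C (compA m n d M i j) * Polynomial.X + Polynomial.C (compB m n d M i j)

/-- The block-diagonal matrix `diag(M(λ), I_{n(d−1)})` over `ℂ[λ]`. -/
noncomputable def polyBlock (m n d : ℕ) (M : Pol d m n) :
    Matrix (Fin (m + n*(d-1))) (Fin (n*d)) (Polynomial ℂ) := fun i j =>
  if hi : (i : ℕ) < m then
    if hj : (j : ℕ) < n then
      ∑ k : Fin (d+1), Polynomial.C (M k ⟨i, hi⟩ ⟨j, hj⟩) * Polynomial.X ^ (k : ℕ)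
    else 0
  else if (i : ℕ) - m = (j : ℕ) - n ∧ n ≤ (j : ℕ) then 1 else 0

/-- The first companion form regarded as a matrix over the field `ℂ(λ)`. -/
noncomputable def compRat (m n d : ℕ) (M : Pol d m n) :
    Matrix (Fin (m + n*(d-1))) (Fin (n*d)) (RatFunc ℂ) := fun i j =>
  RatFunc.C (compA m n d M i j) * RatFunc.X + RatFunc.C (compB m n d M i j)



/-- Polynomial continuation of a kernel vector along a line of linear maps. -/
lemma kernel_line {ι κ : Type*} [Fintype ι] [Fintype κ] [DecidableEq ι] [DecidableEq κ]
    (M0 M1 : Matrix κ ι ℂ) (N : Matrix ι κ ℂ) (hN : M1 * N = 1) (v0 : ι → ℂ)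
    (hv : M1 *ᵥ v0 = 0) :
    ∃ v : ι → Polynomial ℂ, (∀ i, (v i).eval 1 = v0 i) ∧
      ∀ t : ℂ, (M0 + t • (M1 - M0)) *ᵥ (fun i => (v i).eval t) = 0 := by
  let M : Matrix κ ι (Polynomial ℂ) :=
    M0.map Polynomial.C + (Polynomial.X : Polynomial ℂ) • (M1 - M0).map Polynomial.C
  let N' : Matrix ι κ (Polynomial ℂ) := N.map Polynomial.C
  let w : ι → Polynomial ℂ := fun i => Polynomial.C (v0 i)
  have hM : ∀ t : ℂ, M.map (Polynomial.evalRingHom t) = M0 + t • (M1 - M0) := by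
    intro t; ext i j
    simp [M]
  have hN' : ∀ t : ℂ, N'.map (Polynomial.evalRingHom t) = N := by
    intro t; ext i j
    simp [N']
  have hw : ∀ t : ℂ, (Polynomial.evalRingHom t) ∘ w = v0 := by
    intro t; ext i
    simp [w]
  let v : ι → Polynomial ℂ := (M * N').det • w - (N' * (M * N').adjugate) *ᵥ (M *ᵥ w)
  have hMv : M *ᵥ v = 0 := by
    simp only [v, Matrix.mulVec_sub, Matrix.mulVec_smul, Matrix.mulVec_mulVec]
    rw [← Matrix.mul_assoc, ← Matrix.mul_assoc, Matrix.mul_adjugate, Matrix.smul_mul, Matrix.one_mul,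
      Matrix.smul_mulVec, sub_self]
  refine ⟨v, ?_, ?_⟩
  · intro i
    have h1 : (M * N').map (Polynomial.evalRingHom (1:ℂ)) = 1 := by
      rw [Matrix.map_mul, hM, hN']; simp [hN]
    have h2 : Polynomial.evalRingHom (1:ℂ) (M * N').det = 1 := by
      rw [RingHom.map_det, RingHom.mapMatrix_apply, h1, Matrix.det_one]
    have h3 : (fun k => Polynomial.evalRingHom (1:ℂ) ((M *ᵥ w) k)) = 0 := by
      funext k
      rw [RingHom.map_mulVec, hM, hw]; simp [hv]
    have h4 : Polynomial.evalRingHom (1:ℂ) (((N' * (M * N').adjugate) *ᵥ (M *ᵥ w)) i) = 0 := by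
      rw [RingHom.map_mulVec]
      have : (⇑(Polynomial.evalRingHom (1:ℂ)) ∘ (M *ᵥ w)) = 0 := h3
      rw [this]; simp
    change Polynomial.evalRingHom (1:ℂ) (v i) = v0 i
    simp only [v, Pi.sub_apply, Pi.smul_apply, smul_eq_mul, map_sub, map_mul, h2, h4]
    simp [w]
  · intro t
    funext k
    have := congrArg (Polynomial.evalRingHom t) (congrFun hMv k)
    rw [RingHom.map_mulVec, hM] at this
    simpa [Function.comp_def] using this

/-- Strict equivalence over arbitrary finite index types. -/
def SE {p q : Type*} [Fintype p] [Fintype q] [DecidableEq p] [DecidableEq q]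
    (A B C D : Matrix p q ℂ) : Prop :=
  ∃ (U : Matrix p p ℂ) (V : Matrix q q ℂ), IsUnit U ∧ IsUnit V ∧ U * A * V = C ∧ U * B * V = D

section
variable {p q : Type*} [Fintype p] [Fintype q] [DecidableEq p] [DecidableEq q]

lemma SE.trans {A B C D E F : Matrix p q ℂ} (h : SE A B C D) (h' : SE C D E F) :
    SE A B E F := by
  obtain ⟨U, V, hU, hV, rfl, rfl⟩ := h
  obtain ⟨U', V', hU', hV', rfl, rfl⟩ := h'
  exact ⟨U' * U, V * V', hU'.mul hU, hV.mul hV', by simp only [Matrix.mul_assoc],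
    by simp only [Matrix.mul_assoc]⟩

lemma SE.symm {A B C D : Matrix p q ℂ} (h : SE A B C D) : SE C D A B := by
  obtain ⟨U, V, hU, hV, rfl, rfl⟩ := h
  have hU' := (Matrix.isUnit_iff_isUnit_det U).1 hU
  have hV' := (Matrix.isUnit_iff_isUnit_det V).1 hV
  refine ⟨U⁻¹, V⁻¹, (Matrix.isUnit_nonsing_inv_iff).2 hU, (Matrix.isUnit_nonsing_inv_iff).2 hV, ?_, ?_⟩
  · rw [Matrix.mul_assoc, Matrix.mul_assoc (U * A), Matrix.mul_nonsing_inv _ hV', Matrix.mul_one,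
      ← Matrix.mul_assoc, Matrix.nonsing_inv_mul _ hU', Matrix.one_mul]
  · rw [Matrix.mul_assoc, Matrix.mul_assoc (U * B), Matrix.mul_nonsing_inv _ hV', Matrix.mul_one,
      ← Matrix.mul_assoc, Matrix.nonsing_inv_mul _ hU', Matrix.one_mul]

/-- Surjectivity of the tangent map. -/
def TS (G F : Matrix p q ℂ) : Prop :=
  ∀ C D : Matrix p q ℂ, ∃ (X : Matrix p p ℂ) (Y : Matrix q q ℂ),
    X * G - G * Y = C ∧ X * F - F * Y = D

/-- The linear map `(X, Y) ↦ (X G - A Y, X F - B Y)` in coordinates. -/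
noncomputable def Phi (G F A B : Matrix p q ℂ) :
    (((p × p) ⊕ (q × q)) → ℂ) →ₗ[ℂ] (((p × q) ⊕ (p × q)) → ℂ) where
  toFun z := Sum.elim
    (fun k => ((Matrix.of fun i j => z (Sum.inl (i, j))) * G
      - A * (Matrix.of fun i j => z (Sum.inr (i, j)))) k.1 k.2)
    (fun k => ((Matrix.of fun i j => z (Sum.inl (i, j))) * F
      - B * (Matrix.of fun i j => z (Sum.inr (i, j)))) k.1 k.2)
  map_add' z w := by
    ext k
    rcases k with k | k <;>
    simp [Matrix.mul_apply, add_mul, mul_add, Finset.sum_add_distrib] <;> ring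
  map_smul' c z := by
    ext k
    rcases k with k | k <;>
    simp [Matrix.mul_apply, mul_sub, Finset.mul_sum, mul_assoc, mul_left_comm]

lemma Phi_line (G F A B : Matrix p q ℂ) (t : ℂ) :
    Phi G F A B + t • (Phi G F G F - Phi G F A B)
      = Phi G F (A + t • (G - A)) (B + t • (F - B)) := by
  ext1 z
  ext k
  rcases k with k | k <;>
  simp [Phi, Matrix.add_mul, Matrix.sub_mul] <;> ring

lemma SE_line {G F : Matrix p q ℂ} (hs : TS G F) (A B : Matrix p q ℂ) :
    {t : ℂ | ¬ SE (A + t • (G - A)) (B + t • (F - B)) G F}.Finite := by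
  have hsurj : Function.Surjective (Phi G F G F) := by
    intro z
    obtain ⟨X, Y, h1, h2⟩ := hs (Matrix.of fun i j => z (Sum.inl (i, j)))
      (Matrix.of fun i j => z (Sum.inr (i, j)))
    refine ⟨Sum.elim (fun k => X k.1 k.2) (fun k => Y k.1 k.2), ?_⟩
    ext k
    rcases k with ⟨i, j⟩ | ⟨i, j⟩
    · exact congrFun (congrFun h1 i) j
    · exact congrFun (congrFun h2 i) j
  obtain ⟨g, hg⟩ := (Phi G F G F).exists_rightInverse_of_surjective (LinearMap.range_eq_top.2 hsurj)
  obtain ⟨v, hv1, hv2⟩ := kernel_line (LinearMap.toMatrix' (Phi G F A B))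
    (LinearMap.toMatrix' (Phi G F G F)) (LinearMap.toMatrix' g)
    (by rw [← LinearMap.toMatrix'_comp, hg, LinearMap.toMatrix'_id])
    (Sum.elim (fun k => (1 : Matrix p p ℂ) k.1 k.2) (fun k => (1 : Matrix q q ℂ) k.1 k.2))
    (by
      rw [LinearMap.toMatrix'_mulVec]
      ext k
      have e1 : (Matrix.of fun i j => (1 : Matrix p p ℂ) i j) = 1 := rfl
      have e2 : (Matrix.of fun i j => (1 : Matrix q q ℂ) i j) = 1 := rfl
      rcases k with k | k <;> simp [Phi, e1, e2])
  let XX : Matrix p p (Polynomial ℂ) := Matrix.of fun i j => v (Sum.inl (i, j))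
  let YY : Matrix q q (Polynomial ℂ) := Matrix.of fun i j => v (Sum.inr (i, j))
  have hX1 : Polynomial.evalRingHom (1:ℂ) XX.det = 1 := by
    rw [RingHom.map_det]
    have : (Polynomial.evalRingHom (1:ℂ)).mapMatrix XX = 1 := by
      ext i j; simp [XX, hv1]
    rw [this, Matrix.det_one]
  have hY1 : Polynomial.evalRingHom (1:ℂ) YY.det = 1 := by
    rw [RingHom.map_det]
    have : (Polynomial.evalRingHom (1:ℂ)).mapMatrix YY = 1 := by
      ext i j; simp [YY, hv1]
    rw [this, Matrix.det_one]
  have hne : XX.det * YY.det ≠ 0 := by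
    intro h
    have := congrArg (Polynomial.evalRingHom (1:ℂ)) h
    rw [map_mul, hX1, hY1] at this
    simp at this
  refine (Polynomial.finite_setOfPred_isRoot hne).subset ?_
  intro t ht
  by_contra hr
  apply ht
  have hr' : Polynomial.evalRingHom t XX.det * Polynomial.evalRingHom t YY.det ≠ 0 := by
    rw [← map_mul]; exact hr
  rw [RingHom.map_det, RingHom.map_det] at hr'
  set X := (Polynomial.evalRingHom t).mapMatrix XX with hX
  set Y := (Polynomial.evalRingHom t).mapMatrix YY with hY
  have hXu : IsUnit X.det := isUnit_iff_ne_zero.2 (left_ne_zero_of_mul hr')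
  have hYu : IsUnit Y.det := isUnit_iff_ne_zero.2 (right_ne_zero_of_mul hr')
  have h2 := hv2 t
  rw [← map_sub, ← map_smul, ← map_add, LinearMap.toMatrix'_mulVec, Phi_line] at h2
  have e1 : X * G = (A + t • (G - A)) * Y := by
    ext i j
    have := congrFun h2 (Sum.inl (i, j))
    exact sub_eq_zero.1 this
  have e2 : X * F = (B + t • (F - B)) * Y := by
    ext i j
    have := congrFun h2 (Sum.inr (i, j))
    exact sub_eq_zero.1 this
  refine ⟨X⁻¹, Y, (Matrix.isUnit_nonsing_inv_iff).2 ((Matrix.isUnit_iff_isUnit_det X).2 hXu),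
    (Matrix.isUnit_iff_isUnit_det Y).2 hYu, ?_, ?_⟩
  · rw [Matrix.mul_assoc, ← e1, ← Matrix.mul_assoc, Matrix.nonsing_inv_mul _ hXu, Matrix.one_mul]
  · rw [Matrix.mul_assoc, ← e2, ← Matrix.mul_assoc, Matrix.nonsing_inv_mul _ hXu, Matrix.one_mul]

lemma SE_line' {G F G' F' : Matrix p q ℂ} (hs : TS G F) (h : SE G' F' G F) (A B : Matrix p q ℂ) :
    {t : ℂ | ¬ SE (A + t • (G' - A)) (B + t • (F' - B)) G F}.Finite := by
  obtain ⟨U, V, hU, hV, rfl, rfl⟩ := h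
  refine (SE_line hs (U * A * V) (U * B * V)).subset ?_
  intro t ht hse
  apply ht
  refine SE.trans ⟨U, V, hU, hV, ?_, ?_⟩ hse <;>
  simp only [Matrix.mul_add, Matrix.add_mul, Matrix.mul_smul, Matrix.smul_mul, Matrix.mul_sub,
    Matrix.sub_mul]

end

lemma diag_solve (ea eb : ℕ) (h : ea ≤ eb + 1) (E : ℕ → ℕ → ℂ) :
    ∃ X : ℕ → ℕ → ℂ, ∀ i j, i + 1 < ea → j ≤ eb →
      (if j < eb then X (i+1) j else 0) - (if 1 ≤ j then X i (j-1) else 0) = E (i+1) j := by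
  let E' : ℕ → ℕ → ℂ := fun i j => if i < ea ∧ j ≤ eb then E i j else 0
  let X : ℕ → ℕ → ℂ := fun i j =>
    if j < i then ∑ l ∈ Finset.range (j+1), E' (i - l) (j - l)
    else - ∑ l ∈ Finset.range ea, E' (i + l + 1) (j + l + 1)
  have hE : ∀ i j, i + 1 < ea → j ≤ eb → E (i+1) j = E' (i+1) j := by
    intro i j h1 h2; simp [E', h1, h2]
  refine ⟨X, ?_⟩
  intro i j hi hj
  rw [hE i j hi hj]
  rcases j with _ | j
  · have : 0 < eb := by omega
    simp [X, this]
  · simp only [Nat.le_add_left, if_true, Nat.add_sub_cancel]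
    by_cases hji : j < i
    · have : j + 1 < eb := by omega
      simp only [this, if_true, X, hji, Nat.add_lt_add_iff_right]
      rw [Finset.sum_range_succ' _ (j+1)]
      simp
    · simp only [X, hji, Nat.add_lt_add_iff_right, if_false]
      have hz : ∀ i' j' : ℕ, ea ≤ i' ∨ eb < j' → E' i' j' = 0 := by
        intro i' j' h'; simp only [E']; rw [if_neg]; omega
      have key : ∑ l ∈ Finset.range ea, E' (i + l + 1) (j + l + 1)
          = E' (i+1) (j+1) + ∑ l ∈ Finset.range ea, E' (i + 1 + l + 1) (j + 1 + l + 1) := by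
        have h1 := Finset.sum_range_succ (fun l => E' (i + l + 1) (j + l + 1)) ea
        have h2 := Finset.sum_range_succ' (fun l => E' (i + l + 1) (j + l + 1)) ea
        rw [hz (i + ea + 1) _ (Or.inl (by omega)), add_zero] at h1
        rw [← h1, h2, add_comm]
        congr 1
        apply Finset.sum_congr rfl
        intro l _
        congr 1 <;> ring
      rw [key]
      split_ifs with h3
      · ring
      · have : ∑ l ∈ Finset.range ea, E' (i + 1 + l + 1) (j + 1 + l + 1) = 0 := by
          apply Finset.sum_eq_zero
          intro l _
          exact hz _ _ (Or.inr (by omega))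
        rw [this]; ring

lemma block_solve (ea eb : ℕ) (h : ea ≤ eb + 1) (C D : ℕ → ℕ → ℂ) :
    ∃ X Y : ℕ → ℕ → ℂ, ∀ i j, i < ea → j ≤ eb →
      (if j < eb then X i j else 0) - Y i j = C i j ∧
      (if 1 ≤ j then X i (j-1) else 0) - Y (i+1) j = D i j := by
  obtain ⟨X, hX⟩ := diag_solve ea eb h (fun i j => C i j - D (i-1) j)
  refine ⟨X, fun i j => if i < ea then (if j < eb then X i j else 0) - C i j
    else (if 1 ≤ j then X (i-1) (j-1) else 0) - D (i-1) j, ?_⟩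
  intro i j hi hj
  constructor
  · simp only [hi, if_true]; ring
  · by_cases hi' : i + 1 < ea
    · have := hX i j hi' hj
      simp only [hi', if_true]
      simp only [Nat.add_sub_cancel] at this
      linear_combination -this
    · simp only [hi', if_false, Nat.add_sub_cancel]; ring

section
variable {p q : Type*} [Fintype p] [Fintype q] [DecidableEq p] [DecidableEq q]

/-- Diagonal part of a direct sum of `L` blocks. -/
noncomputable def LG {N : ℕ} {e : Fin N → ℕ} (er : p ≃ (Σ b : Fin N, Fin (e b)))
    (ec : q ≃ (Σ b : Fin N, Fin (e b + 1))) : Matrix p q ℂ := fun x y =>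
  if (er x).1 = (ec y).1 ∧ ((ec y).2 : ℕ) = (er x).2 then 1 else 0

/-- Superdiagonal part of a direct sum of `L` blocks. -/
noncomputable def LF {N : ℕ} {e : Fin N → ℕ} (er : p ≃ (Σ b : Fin N, Fin (e b)))
    (ec : q ≃ (Σ b : Fin N, Fin (e b + 1))) : Matrix p q ℂ := fun x y =>
  if (er x).1 = (ec y).1 ∧ ((ec y).2 : ℕ) = (er x).2 + 1 then 1 else 0

lemma sig_ext {N : ℕ} {f : Fin N → ℕ} {u v : Σ b : Fin N, Fin (f b)} (h : u.1 = v.1)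
    (h2 : (u.2 : ℕ) = v.2) : u = v := by
  rcases u with ⟨a, i⟩
  rcases v with ⟨b, j⟩
  obtain rfl : a = b := h
  congr 1
  exact Fin.ext h2

lemma TS_LGF {N : ℕ} {e : Fin N → ℕ} (he : ∀ a b, e a ≤ e b + 1)
    (er : p ≃ (Σ b : Fin N, Fin (e b))) (ec : q ≃ (Σ b : Fin N, Fin (e b + 1))) :
    TS (LG er ec) (LF er ec) := by
  intro C D
  let Cf : Fin N → Fin N → ℕ → ℕ → ℂ := fun a b i j =>
    if h : i < e a ∧ j < e b + 1 then C (er.symm ⟨a, i, h.1⟩) (ec.symm ⟨b, j, h.2⟩) else 0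
  let Df : Fin N → Fin N → ℕ → ℕ → ℂ := fun a b i j =>
    if h : i < e a ∧ j < e b + 1 then D (er.symm ⟨a, i, h.1⟩) (ec.symm ⟨b, j, h.2⟩) else 0
  choose X Y hXY using fun a b => block_solve (e a) (e b) (he a b) (Cf a b) (Df a b)
  let XX : Matrix p p ℂ := fun x x' => X (er x).1 (er x').1 (er x).2 (er x').2
  let YY : Matrix q q ℂ := fun x x' => Y (ec x).1 (ec x').1 (ec x).2 (ec x').2
  have hr : ∀ u, ((er (er.symm u)).2 : ℕ) = u.2 := by
    intro u; rw [Equiv.apply_symm_apply]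
  have hc : ∀ u, ((ec (ec.symm u)).2 : ℕ) = u.2 := by
    intro u; rw [Equiv.apply_symm_apply]
  refine ⟨XX, YY, ?_, ?_⟩
  · ext x y
    have h := (hXY (er x).1 (ec y).1 (er x).2 (ec y).2 (er x).2.2 (Nat.le_of_lt_succ (ec y).2.2)).1
    have hC : Cf (er x).1 (ec y).1 (er x).2 (ec y).2 = C x y := by
      have h0 : ((er x).2 : ℕ) < e (er x).1 ∧ ((ec y).2 : ℕ) < e (ec y).1 + 1 :=
        ⟨(er x).2.2, (ec y).2.2⟩
      simp only [Cf, dif_pos h0, Fin.eta, Sigma.eta, Equiv.symm_apply_apply]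
    rw [hC] at h
    rw [← h, Matrix.sub_apply, Matrix.mul_apply, Matrix.mul_apply]
    congr 1
    · split_ifs with hj
      · rw [Finset.sum_eq_single (er.symm ⟨(ec y).1, ⟨(ec y).2, hj⟩⟩)]
        · simp [XX, LG, hr, hc]
        · intro x' _ hx'
          rw [LG, if_neg, mul_zero]
          rintro ⟨h1, h2⟩
          apply hx'
          rw [Equiv.eq_symm_apply]
          exact sig_ext h1 h2.symm
        · simp
      · apply Finset.sum_eq_zero
        intro x' _
        rw [LG, if_neg, mul_zero]
        rintro ⟨h1, h2⟩
        apply hj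
        rw [h2, ← h1]
        exact (er x').2.2
    · rw [Finset.sum_eq_single (ec.symm ⟨(er x).1, ⟨(er x).2, by omega⟩⟩)]
      · simp [YY, LG, hr, hc]
      · intro x' _ hx'
        rw [LG, if_neg, zero_mul]
        rintro ⟨h1, h2⟩
        apply hx'
        rw [Equiv.eq_symm_apply]
        exact sig_ext h1.symm h2
      · simp
  · ext x y
    have h := (hXY (er x).1 (ec y).1 (er x).2 (ec y).2 (er x).2.2 (Nat.le_of_lt_succ (ec y).2.2)).2
    have hC : Df (er x).1 (ec y).1 (er x).2 (ec y).2 = D x y := by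
      have h0 : ((er x).2 : ℕ) < e (er x).1 ∧ ((ec y).2 : ℕ) < e (ec y).1 + 1 :=
        ⟨(er x).2.2, (ec y).2.2⟩
      simp only [Df, dif_pos h0, Fin.eta, Sigma.eta, Equiv.symm_apply_apply]
    rw [hC] at h
    rw [← h, Matrix.sub_apply, Matrix.mul_apply, Matrix.mul_apply]
    congr 1
    · split_ifs with hj
      · rw [Finset.sum_eq_single (er.symm ⟨(ec y).1, ⟨(ec y).2 - 1, by omega⟩⟩)]
        · have h5 : ((ec y).2 : ℕ) = (ec y).2 - 1 + 1 := by omega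
          simp only [XX, LF, Equiv.apply_symm_apply, hr]
          rw [if_pos ⟨trivial, h5⟩, mul_one]
        · intro x' _ hx'
          rw [LF, if_neg, mul_zero]
          rintro ⟨h1, h2⟩
          apply hx'
          rw [Equiv.eq_symm_apply]
          exact sig_ext h1 (by simp only; omega)
        · simp
      · apply Finset.sum_eq_zero
        intro x' _
        rw [LF, if_neg, mul_zero]
        rintro ⟨h1, h2⟩
        omega
    · rw [Finset.sum_eq_single (ec.symm ⟨(er x).1, ⟨(er x).2 + 1, by omega⟩⟩)]
      · simp [YY, LF, hr, hc]
      · intro x' _ hx'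
        rw [LF, if_neg, zero_mul]
        rintro ⟨h1, h2⟩
        apply hx'
        rw [Equiv.eq_symm_apply]
        exact sig_ext h1.symm h2
      · simp

/-- Swapping the roles and changing a sign preserves surjectivity of the tangent map. -/
lemma TS.swap_neg {G F : Matrix p q ℂ} (h : TS G F) : TS F (-G) := by
  intro C D
  obtain ⟨X, Y, h1, h2⟩ := h (-D) C
  refine ⟨X, Y, h2, ?_⟩
  rw [Matrix.mul_neg, Matrix.neg_mul, ← neg_eq_iff_eq_neg.2 h1]
  abel

end

lemma off_succ (f : ℕ → ℕ) (b : ℕ) : off f (b+1) = off f b + f b := by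
  simp [off, Finset.sum_range_succ]

lemma off_mono (f : ℕ → ℕ) {a b : ℕ} (h : a ≤ b) : off f a ≤ off f b := by
  induction h with
  | refl => exact le_rfl
  | step _ ih => rw [off_succ]; omega

lemma off_unique (f : ℕ → ℕ) {a b x : ℕ} (h1 : off f a ≤ x) (h2 : x < off f a + f a)
    (h3 : off f b ≤ x) (h4 : x < off f b + f b) : a = b := by
  rw [← off_succ] at h2 h4
  rcases lt_trichotomy a b with h | h | h
  · have := off_mono f (show a + 1 ≤ b from h); omega
  · exact h
  · have := off_mono f (show b + 1 ≤ a from h); omega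

lemma dsum_apply (N : ℕ) (ρ γ : ℕ → ℕ) (ent : ℕ → ℕ → ℕ → ℂ) (p q : ℕ) (x : Fin p) (y : Fin q)
    (b b' i j : ℕ) (hb : b < N) (hi : i < ρ b) (hx : (x : ℕ) = off ρ b + i)
    (hj : j < γ b') (hy : (y : ℕ) = off γ b' + j) :
    dsum N ρ γ ent p q x y = if b = b' then ent b i j else 0 := by
  unfold dsum
  rw [Finset.sum_eq_single b]
  · by_cases hbb : b = b'
    · subst hbb
      rw [if_pos (by omega), if_pos rfl]
      congr 1 <;> omega
    · rw [if_neg, if_neg hbb]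
      rintro ⟨_, _, h3, h4⟩
      exact hbb (off_unique γ h3 h4 (by omega) (by omega))
  · intro c _ hc
    rw [if_neg]
    rintro ⟨h1, h2, _, _⟩
    exact hc (off_unique ρ h1 h2 (by omega) (by omega))
  · intro h
    exact absurd (Finset.mem_range.2 hb) h

lemma exists_sigma_equiv (N : ℕ) (e : ℕ → ℕ) (p : ℕ) (hp : off e N = p) :
    ∃ er : Fin p ≃ (Σ b : Fin N, Fin (e b)), ∀ x : Fin p, (x : ℕ) = off e (er x).1 + (er x).2 := by
  have h : p = ∑ b : Fin N, e b := by
    rw [← hp, off, Finset.sum_range]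
  refine ⟨(finCongr h).trans finSigmaFinEquiv.symm, ?_⟩
  intro x
  have h1 := finSigmaFinEquiv_apply (((finCongr h).trans finSigmaFinEquiv.symm) x)
  rw [Equiv.trans_apply, Equiv.apply_symm_apply] at h1
  rw [finCongr_apply_coe] at h1
  rw [h1, off, Finset.sum_range]
  rfl

lemma sum_ind (N s : ℕ) : ∑ i ∈ Finset.range N, (if i < s then 1 else 0) = min N s := by
  induction N with
  | zero => simp
  | succ N ih => rw [Finset.sum_range_succ, ih]; split_ifs <;> omega

lemma off_secSize (c1 c2 ε u v : ℕ) :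
    off (secSize c1 c2 0 (ε+1) ε u v) (c1+c2) = (c1+c2)*ε + c1 := by
  have : ∀ i ∈ Finset.range (c1+c2), secSize c1 c2 0 (ε+1) ε u v i = ε + if i < c1 then 1 else 0 := by
    intro i hi
    have := Finset.mem_range.1 hi
    unfold secSize
    split_ifs <;> omega
  rw [off, Finset.sum_congr rfl this, Finset.sum_add_distrib, sum_ind]
  simp

lemma genPencil_TS (c1 c2 ε p q : ℕ) (hp : (c1+c2)*ε + c1 = p) (hq : (c1+c2)*(ε+1) + c1 = q) :
    TS (genPencil c1 c2 0 0 (ε+1) ε 0 0 p q).1 (genPencil c1 c2 0 0 (ε+1) ε 0 0 p q).2 := by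
  set e : ℕ → ℕ := secSize c1 c2 0 (ε+1) ε 1 1 with he
  set γ : ℕ → ℕ := secSize c1 c2 0 (ε+1+1) (ε+1) 0 0 with hγ
  have hγe : ∀ b, b < c1 + c2 → γ b = e b + 1 := by
    intro b hb
    simp only [he, hγ, secSize]
    split_ifs <;> omega
  have hoff : ∀ b, b ≤ c1 + c2 → off γ b = off (fun b => e b + 1) b := by
    intro b hb
    apply Finset.sum_congr rfl
    intro i hi
    exact hγe i (by have := Finset.mem_range.1 hi; omega)
  obtain ⟨er, her⟩ := exists_sigma_equiv (c1+c2) e p (by rw [he, off_secSize, hp])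
  obtain ⟨ec, hec⟩ := exists_sigma_equiv (c1+c2) (fun b => e b + 1) q
    (by rw [← hoff _ le_rfl, hγ, off_secSize, hq])
  have key := TS_LGF (e := fun b : Fin (c1+c2) => e b) (by
    intro a b
    have ha := a.2
    have hb := b.2
    simp only [he, secSize]
    split_ifs <;> omega) er ec
  have hgen : ∀ ent : ℕ → ℕ → ℕ → ℂ, ∀ x y, dsum (c1+c2) e γ ent p q x y
      = if (er x).1 = (ec y).1 then ent (er x).1 (er x).2 (ec y).2 else 0 := by
    intro ent x y
    rw [dsum_apply (c1+c2) e γ ent p q x y (er x).1 (ec y).1 (er x).2 (ec y).2 (er x).1.2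
      (er x).2.2 (her x) (by rw [hγe _ (ec y).1.2]; exact (ec y).2.2)
      (by rw [hoff _ (ec y).1.2.le]; exact hec y)]
    simp only [Fin.ext_iff]
  have e1 : (genPencil c1 c2 0 0 (ε+1) ε 0 0 p q).1 = LG er ec := by
    ext x y
    refine (hgen (fun _ i j => if i = j then 1 else 0) x y).trans ?_
    simp only [LG, ite_and]
    simp only [eq_comm]
  have e2 : (genPencil c1 c2 0 0 (ε+1) ε 0 0 p q).2 = LF er ec := by
    ext x y
    refine (hgen (fun b i j => if b < c1 + c2 then (if j = i+1 then 1 else 0)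
       else (if i = j+1 then 1 else 0)) x y).trans ?_
    simp only [LF, ite_and, (er x).1.2, if_true]
  rw [e1, e2]
  exact key

lemma Grp_TS (m n d : ℕ) (hmn : m < n) (hd : 1 ≤ d) : TS (Grp m n d).1 (Grp m n d).2 := by
  obtain ⟨D, rfl⟩ : ∃ D, d = D + 1 := ⟨d - 1, by omega⟩
  obtain ⟨k, rfl⟩ : ∃ k, n = m + k := ⟨n - m, by omega⟩
  have hk : 0 < k := by omega
  have hlt := Nat.mod_lt (m*(D+1)) hk
  have hdiv := Nat.div_add_mod (m*(D+1)) k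
  unfold Grp
  simp only [Nat.add_sub_cancel_left, Nat.add_sub_cancel]
  rw [show m*(D+1)/k + (D+1) = (m*(D+1)/k + D) + 1 by ring, Nat.add_sub_cancel]
  generalize m*(D+1)/k = α at *
  generalize m*(D+1)%k = s at *
  apply genPencil_TS
  · rw [show s + (k - s) = k by omega]; linear_combination hdiv
  · rw [show s + (k - s) = k by omega]; linear_combination hdiv

/-- The leading part of the bottom rows of a companion form. -/
noncomputable def KA (n D : ℕ) : Matrix (Fin (n*D)) (Fin (n*(D+1))) ℂ := fun i j =>
  if (i : ℕ) = (j : ℕ) - n ∧ n ≤ (j : ℕ) then 1 else 0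

/-- The constant part of the bottom rows of a companion form. -/
noncomputable def KB (n D : ℕ) : Matrix (Fin (n*D)) (Fin (n*(D+1))) ℂ := fun i j =>
  if (j : ℕ) = (i : ℕ) then -1 else 0

lemma exists_prod_equiv (n D : ℕ) : ∃ er : Fin (n*D) ≃ (Σ _ : Fin n, Fin D),
    ∀ x : Fin (n*D), ((er x).1 : ℕ) = x % n ∧ ((er x).2 : ℕ) = x / n := by
  refine ⟨(finCongr (Nat.mul_comm n D)).trans (finProdFinEquiv.symm.trans
    ((Equiv.prodComm _ _).trans (Equiv.sigmaEquivProd _ _).symm)), ?_⟩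
  intro x
  constructor <;> simp

lemma K_TS (n D : ℕ) (hn : 0 < n) : TS (KA n D) (KB n D) := by
  obtain ⟨er, her⟩ := exists_prod_equiv n D
  obtain ⟨ec, hec⟩ := exists_prod_equiv n (D+1)
  have key := (TS_LGF (e := fun _ : Fin n => D) (by intro a b; omega) er ec).swap_neg
  have e1 : KA n D = LF er ec := by
    ext x y
    simp only [KA, LF, Fin.ext_iff, her, hec]
    congr 1
    rw [eq_iff_iff]
    have hx := Nat.div_add_mod (x : ℕ) n
    have hy := Nat.div_add_mod (y : ℕ) n
    constructor
    · rintro ⟨h1, h2⟩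
      have : (y : ℕ) = x + n := by omega
      rw [this]
      simp [hn]
    · rintro ⟨h1, h2⟩
      rw [h2, ← h1] at hy
      have : (y : ℕ) = x + n := by linear_combination hx - hy
      omega
  have e2 : KB n D = - LG er ec := by
    ext x y
    simp only [KB, LG, Fin.ext_iff, her, hec, Matrix.neg_apply]
    have : ((y : ℕ) = x) ↔ ((x : ℕ) % n = y % n ∧ (y : ℕ) / n = x / n) := by
      have hx := Nat.div_add_mod (x : ℕ) n
      have hy := Nat.div_add_mod (y : ℕ) n
      constructor
      · intro h; rw [h]; simp
      · rintro ⟨h1, h2⟩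
        rw [h2, ← h1] at hy
        omega
    by_cases h : (y : ℕ) = x
    · rw [if_pos h, if_pos (this.1 h)]
    · rw [if_neg h, if_neg (fun h' => h (this.2 h')), neg_zero]
  rw [e1, e2]
  exact key

lemma SE_reindex {p p' q : Type*} [Fintype p] [Fintype p'] [Fintype q] [DecidableEq p]
    [DecidableEq p'] [DecidableEq q] (f : p' ≃ p) {A B C D : Matrix p q ℂ}
    (h : SE (A.submatrix f id) (B.submatrix f id) (C.submatrix f id) (D.submatrix f id)) :
    SE A B C D := by
  obtain ⟨U, V, hU, hV, h1, h2⟩ := h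
  have aux : ∀ M M' : Matrix p q ℂ, U * M.submatrix f id * V = M'.submatrix f id →
      U.submatrix f.symm f.symm * M * V = M' := by
    intro M M' h
    have h' := congrArg (fun Z => Z.submatrix f.symm id) h
    simp only [Matrix.submatrix_submatrix, Function.comp_id, Equiv.self_comp_symm,
      Matrix.submatrix_id_id] at h'
    rw [← h']
    ext x y
    simp only [Matrix.mul_apply, Matrix.submatrix_apply, id]
    refine Finset.sum_congr rfl fun j _ => ?_
    congr 1
    rw [← f.sum_comp]
    simp
  exact ⟨U.submatrix f.symm f.symm, V, (Matrix.isUnit_submatrix_equiv _ _).2 hU, hV,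
    aux _ _ h1, aux _ _ h2⟩

lemma companion_of_bottom (m n D : ℕ) (hn : 0 < n)
    (A B : Matrix (Fin (m + n*D)) (Fin (n*(D+1))) ℂ)
    (h : SE (A.submatrix (Fin.natAdd m) id) (B.submatrix (Fin.natAdd m) id) (KA n D) (KB n D)) :
    ∃ P : Pol (D+1) m n, SE A B (compA m n (D+1) P) (compB m n (D+1) P) := by
  obtain ⟨U, V, hU, hV, h1, h2⟩ := h
  set A1 := A.submatrix (Fin.castAdd (n*D)) id with hA1
  set A2 := A.submatrix (Fin.natAdd m) id with hA2
  set B1 := B.submatrix (Fin.castAdd (n*D)) id with hB1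
  set B2 := B.submatrix (Fin.natAdd m) id with hB2
  have hA : A.submatrix finSumFinEquiv id = Matrix.fromRows A1 A2 := by
    ext (i | i) j <;> rfl
  have hB : B.submatrix finSumFinEquiv id = Matrix.fromRows B1 B2 := by
    ext (i | i) j <;> rfl
  have hnD : n * (D+1) = n*D + n := by ring
  let Z : Matrix (Fin m) (Fin (n*D)) ℂ := fun i k => (A1 * V) i ⟨k + n, by omega⟩
  let TA : Matrix (Fin m) (Fin (n*(D+1))) ℂ := A1 * V - Z * KA n D
  let TB : Matrix (Fin m) (Fin (n*(D+1))) ℂ := B1 * V - Z * KB n D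
  have hTA : ∀ (i : Fin m) (j : Fin (n*(D+1))), n ≤ (j : ℕ) → TA i j = 0 := by
    intro i j hj
    have : (Z * KA n D) i j = (A1 * V) i j := by
      rw [Matrix.mul_apply, Finset.sum_eq_single ⟨j - n, by omega⟩]
      · simp only [KA, hj, and_self, if_true, mul_one, Z]
        have h6 : (⟨(j : ℕ) - n + n, by omega⟩ : Fin (n*(D+1))) = j := by
          apply Fin.ext
          simp only
          omega
        rw [h6]
      · intro k _ hk
        rw [KA, if_neg, mul_zero]
        rintro ⟨h3, _⟩
        exact hk (Fin.ext h3)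
      · simp
    simp only [TA, Matrix.sub_apply, this, sub_self]
  let P : Pol (D+1) m n := fun k => Matrix.of fun i r =>
    if hk : (k : ℕ) = D + 1 then TA i ⟨r, by nlinarith [r.2]⟩
    else TB i ⟨n * (D - k) + r, by
      have : n * (D - k) ≤ n * D := Nat.mul_le_mul_left _ (Nat.sub_le _ _)
      have := r.2
      omega⟩
  refine ⟨P, SE_reindex finSumFinEquiv ?_⟩
  rw [hA, hB]
  refine ⟨Matrix.fromBlocks 1 (-(Z * U)) 0 U, V, ?_, hV, ?_, ?_⟩
  · rw [Matrix.isUnit_iff_isUnit_det, Matrix.det_fromBlocks_zero₂₁, Matrix.det_one, one_mul]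
    exact (Matrix.isUnit_iff_isUnit_det U).1 hU
  · rw [Matrix.fromBlocks_mul_fromRows, Matrix.fromRows_mul]
    have e1 : ((1 : Matrix (Fin m) (Fin m) ℂ) * A1 + -(Z * U) * A2) * V = TA := by
      simp only [TA]
      rw [← h1]
      simp only [Matrix.one_mul, Matrix.neg_mul, Matrix.add_mul, Matrix.mul_assoc]
      abel
    have e2 : ((0 : Matrix (Fin (n*D)) (Fin m) ℂ) * A1 + U * A2) * V = KA n D := by
      rw [Matrix.zero_mul, zero_add, h1]
    rw [e1, e2]
    ext (i | i) j
    · have hi : ((Fin.castAdd (n*D) i : Fin (m + n*D)) : ℕ) < m := i.2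
      change TA i j = compA m n (D+1) P (Fin.castAdd (n*D) i) j
      unfold compA
      rw [dif_pos hi]
      split_ifs with hj
      · simp [P]
      · exact hTA i j (by omega)
    · change KA n D i j = compA m n (D+1) P (Fin.natAdd m i) j
      simp [compA, KA]
  · rw [Matrix.fromBlocks_mul_fromRows, Matrix.fromRows_mul]
    have e1 : ((1 : Matrix (Fin m) (Fin m) ℂ) * B1 + -(Z * U) * B2) * V = TB := by
      simp only [TB]
      rw [← h2]
      simp only [Matrix.one_mul, Matrix.neg_mul, Matrix.add_mul, Matrix.mul_assoc]
      abel
    have e2 : ((0 : Matrix (Fin (n*D)) (Fin m) ℂ) * B1 + U * B2) * V = KB n D := by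
      rw [Matrix.zero_mul, zero_add, h2]
    rw [e1, e2]
    ext (i | i) j
    · have hi : ((Fin.castAdd (n*D) i : Fin (m + n*D)) : ℕ) < m := i.2
      change TB i j = compB m n (D+1) P (Fin.castAdd (n*D) i) j
      unfold compB
      rw [dif_pos hi, dif_pos hn]
      have hj : (j : ℕ) / n < D + 1 := Nat.div_lt_of_lt_mul j.2
      have hdm := Nat.div_add_mod (j : ℕ) n
      simp only [P, Matrix.of_apply]
      have q1 : ∀ c : ℕ, D + 1 - 1 - c ≠ D + 1 := by intro c; omega
      have q2 : ∀ c : ℕ, c < D + 1 → D - (D + 1 - 1 - c) = c := by intro c hc; omega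
      rw [dif_neg (q1 _)]
      have h6 : ∀ j' : Fin (n*(D+1)), (j' : ℕ) = j → TB i j = TB i j' := by
        intro j' hj'
        rw [Fin.ext hj']
      apply h6
      simp only
      rw [q2 _ hj, hdm]
    · change KB n D i j = compB m n (D+1) P (Fin.natAdd m i) j
      simp [compB, KB]

lemma SE.strictEquiv {p q : ℕ} {L M : Pencil p q} (h : SE L.1 L.2 M.1 M.2) : StrictEquiv L M := by
  obtain ⟨U, V, hU, hV, h1, h2⟩ := h
  refine ⟨U⁻¹, V, (Matrix.isUnit_nonsing_inv_iff).2 hU, hV, ?_, ?_⟩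
  · rw [Matrix.nonsing_inv_nonsing_inv _ ((Matrix.isUnit_iff_isUnit_det U).1 hU), h1]
  · rw [Matrix.nonsing_inv_nonsing_inv _ ((Matrix.isUnit_iff_isUnit_det U).1 hU), h2]

lemma exists_companion (m n D : ℕ) (hmn : m < n) : ∃ P : Pol (D+1) m n,
    SE (compA m n (D+1) P) (compB m n (D+1) P) (Grp m n (D+1)).1 (Grp m n (D+1)).2 := by
  have hn : 0 < n := by omega
  set GA : Matrix (Fin (m + n*D)) (Fin (n*(D+1))) ℂ := (Grp m n (D+1)).1 with hGA
  set GB : Matrix (Fin (m + n*D)) (Fin (n*(D+1))) ℂ := (Grp m n (D+1)).2 with hGB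
  set CA : Matrix (Fin (m + n*D)) (Fin (n*(D+1))) ℂ := compA m n (D+1) 0 with hCA
  set CB : Matrix (Fin (m + n*D)) (Fin (n*(D+1))) ℂ := compB m n (D+1) 0 with hCB
  have hG : TS GA GB := Grp_TS m n (D+1) hmn (by omega)
  have f1 := SE_line hG CA CB
  have f2 := SE_line (K_TS n D hn) (GA.submatrix (Fin.natAdd m) id) (GB.submatrix (Fin.natAdd m) id)
  obtain ⟨t, ht⟩ := (f1.union (f2.image (fun s => 1 - s))).exists_notMem
  simp only [Set.mem_union, not_or] at ht
  obtain ⟨t1, t2⟩ := ht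
  have t1' : SE (CA + t • (GA - CA)) (CB + t • (GB - CB)) GA GB := by
    by_contra h
    exact t1 h
  have t2' : SE (GA.submatrix (Fin.natAdd m) id + (1 - t) • (KA n D - GA.submatrix (Fin.natAdd m) id))
      (GB.submatrix (Fin.natAdd m) id + (1 - t) • (KB n D - GB.submatrix (Fin.natAdd m) id))
      (KA n D) (KB n D) := by
    by_contra h
    exact t2 ⟨1 - t, h, by ring⟩
  have c1 : KA n D = CA.submatrix (Fin.natAdd m) id := by
    ext i j
    change KA n D i j = compA m n (D+1) 0 (Fin.natAdd m i) j
    simp [compA, KA]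
  have c2 : KB n D = CB.submatrix (Fin.natAdd m) id := by
    ext i j
    change KB n D i j = compB m n (D+1) 0 (Fin.natAdd m i) j
    simp [compB, KB]
  obtain ⟨P, hP⟩ := companion_of_bottom m n D hn (CA + t • (GA - CA)) (CB + t • (GB - CB)) (by
    convert t2' using 1
    · rw [c1]; ext i j; simp; ring
    · rw [c2]; ext i j; simp; ring)
  exact ⟨P, hP.symm.trans t1'⟩

lemma compA_line (m n d : ℕ) (P Q : Pol d m n) (t : ℂ) :
    compA m n d (P + t • (Q - P)) = compA m n d P + t • (compA m n d Q - compA m n d P) := by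
  ext i j
  simp only [compA, Matrix.add_apply, Matrix.smul_apply, Matrix.sub_apply]
  split_ifs <;> simp

lemma compB_line (m n d : ℕ) (P Q : Pol d m n) (t : ℂ) :
    compB m n d (P + t • (Q - P)) = compB m n d P + t • (compB m n d Q - compB m n d P) := by
  ext i j
  simp only [compB, Matrix.add_apply, Matrix.smul_apply, Matrix.sub_apply]
  split_ifs <;> simp

/-- Case `m < n`:  the set of polynomials whose first companion form is
strictly equivalent to `G_rp` is dense in `POL_{d,m×n}`. -/
theorem dense_Grp_eigenstructure (m n d : ℕ) (hm : 1 ≤ m) (hmn : m < n) (hd : 1 ≤ d) :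
    closure {P : Pol d m n | StrictEquiv (comp m n d P) (Grp m n d)} = Set.univ := by
  obtain ⟨D, rfl⟩ : ∃ D, d = D + 1 := ⟨d - 1, by omega⟩
  obtain ⟨P0, hP0⟩ := exists_companion m n D hmn
  rw [Set.eq_univ_iff_forall]
  intro P
  have hfin := SE_line' (Grp_TS m n (D+1) hmn hd) hP0 (compA m n (D+1) P) (compB m n (D+1) P)
  have hdense := hfin.countable.dense_compl ℂ
  let f : ℂ → Pol (D+1) m n := fun t => P + t • (P0 - P)
  have hf : Continuous f := by fun_prop
  have h0 : f 0 = P := by simp [f]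
  have hmem : f 0 ∈ f '' closure {t : ℂ | ¬ SE (compA m n (D+1) P + t • (compA m n (D+1) P0
      - compA m n (D+1) P)) (compB m n (D+1) P + t • (compB m n (D+1) P0 - compB m n (D+1) P))
      (Grp m n (D+1)).1 (Grp m n (D+1)).2}ᶜ := ⟨0, hdense 0, rfl⟩
  rw [← h0]
  refine closure_mono ?_ (image_closure_subset_closure_image hf hmem)
  rintro _ ⟨t, ht, rfl⟩
  apply SE.strictEquiv
  have ht' := not_not.1 ht
  change SE (compA m n (D+1) (P + t • (P0 - P))) (compB m n (D+1) (P + t • (P0 - P))) _ _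
  rw [compA_line, compB_line]
  exact ht'

end MPoly
end

section
/- Let m, n, d ≥ 1 be integers with m > n, and set β = ⌊nd/(m−n)⌋ and t = nd mod (m−n). Let G_ℓp denote the block-diagonal pencil (direct sum) consisting of t copies of L_{β+1}ᵀ and m−n−t copies of L_βᵀ, a pencil of size (m+n(d−1)) × nd. Then there exists an m×n complex matrix polynomial P of grade d with leading coefficient A_d ≠ 0 (i.e., of degree exactly d) and normal rank exactly n whose first companion form C¹_P is strictly equivalent to G_ℓp. -/
open Matrix Finset

namespace MPoly

/-! ### The block index of a column -/

/-- Index of the block containing column `y`. -/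
def blk (β t y : ℕ) : ℕ := if y < t * (β+1) then y / (β+1) else t + (y - t*(β+1)) / β

/-- Row of the `λ`-entry in column `y`. -/
def rl (β t y : ℕ) : ℕ := y + blk β t y

lemma blk_mono (β t : ℕ) : Monotone (blk β t) := by
  intro x y hxy
  unfold blk
  split_ifs with h1 h2 h2
  · exact Nat.div_le_div_right hxy
  · have : x / (β+1) < t := (Nat.div_lt_iff_lt_mul (by omega)).2 h1
    exact this.le.trans (Nat.le_add_right _ _)
  · omega
  · have := @Nat.div_le_div_right (x - t*(β+1)) (y - t*(β+1)) β (by omega)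
    omega

lemma rl_lt (β t : ℕ) : StrictMono (rl β t) := by
  intro x y hxy
  have := blk_mono β t hxy.le
  unfold rl; omega

lemma off_col (β t b : ℕ) : off (secSize 0 0 t 1 1 (β+1) β) b = b * β + min b t := by
  induction b with
  | zero => simp [off]
  | succ b ih =>
    unfold off at ih ⊢
    rw [Finset.sum_range_succ, ih]
    simp only [secSize]
    rcases lt_or_ge b t with h | h
    · have : min (b+1) t = b+1 := by omega
      have h2 : min b t = b := by omega
      simp [h, this, h2]; ring
    · have : min (b+1) t = t := by omega
      have h2 : min b t = t := by omega
      simp [h.not_gt, this, h2]; ring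

lemma off_row (β t b : ℕ) :
    off (secSize 0 0 t 0 0 (β+1+1) (β+1)) b = b * β + min b t + b := by
  rw [← off_col]
  induction b with
  | zero => simp [off]
  | succ b ih =>
    unfold off at ih ⊢
    rw [Finset.sum_range_succ, Finset.sum_range_succ, ih]
    simp only [secSize]
    split_ifs <;> omega

lemma blk_spec (β t k y : ℕ) (htk : t ≤ k) (hy : y < k * β + t) :
    blk β t y < k ∧ blk β t y * β + min (blk β t y) t ≤ y ∧
      y < (blk β t y + 1) * β + min (blk β t y + 1) t := by
  unfold blk
  split_ifs with h
  · have h1 : y / (β+1) < t := (Nat.div_lt_iff_lt_mul (by omega)).2 h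
    have h2 := Nat.div_add_mod y (β+1)
    have h3 := Nat.mod_lt y (show 0 < β+1 by omega)
    have e1 : min (y / (β+1)) t = y/(β+1) := by omega
    have e2 : min (y / (β+1) + 1) t = y/(β+1) + 1 := by omega
    rw [e1, e2]
    generalize y / (β+1) = q at *
    generalize y % (β+1) = w at *
    refine ⟨by omega, by nlinarith, by nlinarith⟩
  · push Not at h
    obtain ⟨z, rfl⟩ := Nat.exists_eq_add_of_le h
    obtain ⟨l, rfl⟩ := Nat.exists_eq_add_of_le htk
    have hz : z < l * β := by nlinarith
    have hβ : 0 < β := by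
      rcases Nat.eq_zero_or_pos β with h0 | h0
      · subst h0; omega
      · exact h0
    rw [Nat.add_sub_cancel_left]
    have h1 : z / β < l := (Nat.div_lt_iff_lt_mul hβ).2 hz
    have h2 := Nat.div_add_mod z β
    have h3 := Nat.mod_lt z hβ
    generalize z / β = q at *
    generalize z % β = w at *
    have e1 : min (t + q) t = t := by omega
    have e2 : min (t + q + 1) t = t := by omega
    rw [e1, e2]
    refine ⟨by omega, by nlinarith, by nlinarith⟩

lemma rl_bound (β t k y : ℕ) (htk : t ≤ k) (hy : y < k * β + t) :
    rl β t y + 1 < k * β + t + k := by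
  have := (blk_spec β t k y htk hy).1
  unfold rl; omega

lemma colmono (β t : ℕ) : Monotone (fun b => b * β + min b t) := by
  intro a b hab
  have := Nat.mul_le_mul_right β hab
  simp only
  omega

/-- Entries of the direct sum, for entries depending on a shift `e`. -/
lemma dsum_entry (β t k p q e : ℕ) (htk : t ≤ k) (hq : q = k * β + t) (he : e ≤ 1)
    (ent : ℕ → ℕ → ℕ → ℂ) (hent : ∀ b i j, ent b i j = if i = j + e then 1 else 0)
    (x : Fin p) (y : Fin q) :
    dsum k (secSize 0 0 t 0 0 (β+1+1) (β+1)) (secSize 0 0 t 1 1 (β+1) β) ent p q x y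
      = if (x : ℕ) = rl β t y + e then 1 else 0 := by
  have hy : (y : ℕ) < k * β + t := hq ▸ y.2
  obtain ⟨h1, h2, h3⟩ := blk_spec β t k y htk hy
  have hs : ∀ b, secSize 0 0 t 0 0 (β+1+1) (β+1) b = secSize 0 0 t 1 1 (β+1) β b + 1 := by
    intro b; simp only [secSize]; split_ifs <;> omega
  have hstep : ∀ b, b * β + min b t + secSize 0 0 t 1 1 (β+1) β b
      = (b+1) * β + min (b+1) t := by
    intro b
    rw [← off_col, ← off_col]
    simp [off, Finset.sum_range_succ]
  unfold dsum
  rw [Finset.sum_eq_single (blk β t y)]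
  · simp only [off_row, off_col, hs, hent]
    have := hstep (blk β t y)
    unfold rl
    generalize secSize 0 0 t 1 1 (β+1) β (blk β t y) = s at *
    generalize blk β t y = b at *
    generalize b * β + min b t = o at *
    generalize (b+1) * β + min (b+1) t = o' at *
    split_ifs <;> first | rfl | (exfalso; omega)
  · intro b _ hb
    rw [if_neg]
    simp only [off_row, off_col, hs]
    have := hstep b
    rintro ⟨-, -, h4, h5⟩
    rcases lt_or_gt_of_ne hb with h | h
    · have h6 := colmono β t (show b + 1 ≤ blk β t y from h)
      simp only at h6
      omega
    · have h6 := colmono β t (show blk β t y + 1 ≤ b from h)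
      simp only at h6
      omega
  · intro h
    exact absurd (Finset.mem_range.2 h1) h

lemma Glp_entries (m n d : ℕ) (hnm : n < m) :
    (∀ x y, (Glp m n d).1 x y =
      if (x : ℕ) = rl (n*d/(m-n)) (n*d % (m-n)) y then 1 else 0) ∧
    (∀ x y, (Glp m n d).2 x y =
      if (x : ℕ) = rl (n*d/(m-n)) (n*d % (m-n)) y + 1 then 1 else 0) := by
  have ht : n*d % (m-n) < m - n := Nat.mod_lt _ (by omega)
  have hq : n*d = (m-n) * (n*d/(m-n)) + n*d % (m-n) := (Nat.div_add_mod _ _).symm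
  have hN : 0 + 0 + n*d % (m-n) + (m-n - n*d % (m-n)) = m - n := by omega
  constructor
  · intro x y
    have := dsum_entry (n*d/(m-n)) (n*d % (m-n)) (m-n) (m + n*(d-1)) (n*d) 0 ht.le hq
      (by omega) (fun _ i j => if i = j then 1 else 0) (by intros; rfl) x y
    unfold Glp genPencil
    rw [hN]
    exact this
  · intro x y
    have := dsum_entry (n*d/(m-n)) (n*d % (m-n)) (m-n) (m + n*(d-1)) (n*d) 1 ht.le hq
      (by omega) (fun b i j => if b < 0 + 0 then (if j = i+1 then 1 else 0)
       else (if i = j+1 then 1 else 0)) (by intros; simp) x y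
    unfold Glp genPencil
    rw [hN]
    exact this

/-! ### Strict equivalence helper -/

lemma strictEquiv_of_eq {p q : ℕ} (L M : Pencil p q) (U : Matrix (Fin p) (Fin p) ℂ)
    (V : Matrix (Fin q) (Fin q) ℂ) (hU : IsUnit U) (hV : IsUnit V)
    (h1 : M.1 = U * L.1 * V) (h2 : M.2 = U * L.2 * V) : StrictEquiv M L := by
  have hU' := (Matrix.isUnit_iff_isUnit_det U).1 hU
  have hV' := (Matrix.isUnit_iff_isUnit_det V).1 hV
  refine ⟨U, V⁻¹, hU, ?_, ?_, ?_⟩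
  · rw [Matrix.isUnit_nonsing_inv_iff]; exact hV
  · rw [h1, Matrix.mul_assoc U, Matrix.nonsing_inv_mul_cancel_left _ _ hU',
      Matrix.mul_nonsing_inv_cancel_right _ _ hV']
  · rw [h2, Matrix.mul_assoc U, Matrix.nonsing_inv_mul_cancel_left _ _ hU',
      Matrix.mul_nonsing_inv_cancel_right _ _ hV']

lemma isUnit_toMatrix {p : ℕ} (σ : Fin p ≃ Fin p) :
    IsUnit (σ.toPEquiv.toMatrix : Matrix (Fin p) (Fin p) ℂ) := by
  refine IsUnit.of_mul_eq_one (σ.symm.toPEquiv.toMatrix) ?_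
  rw [PEquiv.toMatrix_toPEquiv_mul]
  ext i j
  simp [PEquiv.toMatrix_apply, Matrix.one_apply, Equiv.toPEquiv_apply, eq_comm]

lemma strictEquiv_of_entries {p q : ℕ} (L M : Pencil p q) (T : Matrix (Fin p) (Fin p) ℂ)
    (hT : IsUnit T) (σ : Fin p ≃ Fin p) (τ : Fin q ≃ Fin q) (s : Fin p → ℂ) (s' : Fin q → ℂ)
    (hs : ∀ i, s i ≠ 0) (hs' : ∀ i, s' i ≠ 0)
    (h1 : ∀ i c, M.1 i c = s i * (T * L.1) (σ i) (τ c) * s' c)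
    (h2 : ∀ i c, M.2 i c = s i * (T * L.2) (σ i) (τ c) * s' c) : StrictEquiv M L := by
  have hd : ∀ {r : ℕ} (f : Fin r → ℂ), (∀ i, f i ≠ 0) → IsUnit (Matrix.diagonal f) := by
    intro r f hf
    rw [Matrix.isUnit_iff_isUnit_det, Matrix.det_diagonal, isUnit_iff_ne_zero]
    exact Finset.prod_ne_zero_iff.2 fun i _ => hf i
  have key : ∀ X : Matrix (Fin p) (Fin q) ℂ, ∀ i c,
      ((Matrix.diagonal s * (σ.toPEquiv.toMatrix * T)) * X *
        (τ.symm.toPEquiv.toMatrix * Matrix.diagonal s') : Matrix (Fin p) (Fin q) ℂ) i c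
        = s i * (T * X) (σ i) (τ c) * s' c := by
    intro X i c
    rw [← Matrix.mul_assoc, Matrix.mul_diagonal, Matrix.mul_assoc, Matrix.mul_assoc,
      Matrix.diagonal_mul, PEquiv.mul_toMatrix_toPEquiv, Matrix.mul_assoc,
      PEquiv.toMatrix_toPEquiv_mul]
    rfl
  refine strictEquiv_of_eq L M (Matrix.diagonal s * (σ.toPEquiv.toMatrix * T))
    (τ.symm.toPEquiv.toMatrix * Matrix.diagonal s') ?_ ?_ ?_ ?_
  · exact (hd s hs).mul ((isUnit_toMatrix σ).mul hT)
  · exact (isUnit_toMatrix _).mul (hd s' hs')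
  · ext i c; rw [h1, key]
  · ext i c; rw [h2, key]

/-! ### Normal rank -/

open Polynomial in
lemma nrank_eq {m n d : ℕ} (P : Pol d m n)
    (h : ∀ j, ∃ i, ∀ j', P (Fin.last d) i j' = if j' = j then 1 else 0) : nrank P = n := by
  classical
  let p : Fin m → Fin n → ℂ[X] := fun i j => ∑ k : Fin (d+1), C (P k i j) * X ^ (k : ℕ)
  have hp : ∀ i j, ratMatrix P i j = algebraMap ℂ[X] (RatFunc ℂ) (p i j) := by
    intro i j
    simp [ratMatrix, p, RatFunc.algebraMap_C, RatFunc.algebraMap_X]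
  have hdeg : ∀ i j, (p i j).natDegree ≤ d := by
    intro i j
    refine natDegree_sum_le_of_forall_le _ _ fun k _ => ?_
    exact (natDegree_C_mul_X_pow_le _ _).trans (by omega)
  have hcoeff : ∀ i j, (p i j).coeff d = P (Fin.last d) i j := by
    intro i j
    simp only [p, finsetSum_coeff, coeff_C_mul_X_pow]
    rw [Finset.sum_eq_single (Fin.last d)]
    · simp
    · intro k _ hk
      rw [if_neg]
      intro h'
      exact hk (Fin.ext (by simpa using h'.symm))
    · simp
  have hli : LinearIndependent (RatFunc ℂ) (ratMatrix P)ᵀ.row := by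
    rw [← LinearIndependent.iff_fractionRing ℂ[X] (RatFunc ℂ), Fintype.linearIndependent_iff]
    intro g hg
    have hg' : ∀ i, ∑ j, g j * p i j = 0 := by
      intro i
      apply RatFunc.algebraMap_injective ℂ
      have := congrFun hg i
      rw [Finset.sum_apply, Pi.zero_apply] at this
      rw [map_sum, map_zero, ← this]
      refine Finset.sum_congr rfl fun j _ => ?_
      rw [map_mul, ← hp, ← Algebra.smul_def]
      rfl
    set D := Finset.univ.sup fun j => (g j).natDegree with hD
    have hle : ∀ j, (g j).natDegree ≤ D := fun j =>
      Finset.le_sup (f := fun j => (g j).natDegree) (Finset.mem_univ j)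
    have h0 : ∀ j, (g j).coeff D = 0 := by
      intro j
      obtain ⟨i, hi⟩ := h j
      have := congrArg (fun f => f.coeff (D + d)) (hg' i)
      simp only [finsetSum_coeff, coeff_zero] at this
      rw [Finset.sum_congr rfl (fun j _ =>
        coeff_mul_add_eq_of_natDegree_le (hle j) (hdeg i j))] at this
      simpa [hcoeff, hi] using this
    intro j
    obtain ⟨j₀, -, hj₀⟩ := Finset.exists_mem_eq_sup Finset.univ ⟨j, Finset.mem_univ j⟩
      (fun j => (g j).natDegree)
    have hz : g j₀ = 0 := by
      rw [← leadingCoeff_eq_zero, leadingCoeff, ← hj₀]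
      exact h0 j₀
    have hD0 : D = 0 := by rw [hD, hj₀, hz, natDegree_zero]
    have h1 := hle j
    rw [hD0] at h1
    rw [eq_C_of_natDegree_le_zero h1]
    have := h0 j
    rw [hD0] at this
    simp [this]
  have := hli.rank_matrix
  rw [Matrix.rank_transpose] at this
  simpa [nrank] using this

/-! ### The column permutation -/

/-- Position in the long path of the companion column `c`. -/
def tn (n d c : ℕ) : ℕ := (c % n) * d + c / n

lemma tn_spec (n d c : ℕ) (hn : 0 < n) (hc : c < n * d) :
    tn n d c < n * d ∧ tn n d c % d = c / n ∧ tn n d c / d = c % n := by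
  have h1 : c / n < d := Nat.div_lt_of_lt_mul hc
  have h2 : c % n < n := Nat.mod_lt _ hn
  have hd : 0 < d := (Nat.zero_le _).trans_lt h1
  unfold tn
  generalize c / n = a at *
  generalize c % n = b at *
  refine ⟨by nlinarith, ?_, ?_⟩
  · rw [mul_comm, Nat.mul_add_mod, Nat.mod_eq_of_lt h1]
  · rw [mul_comm, Nat.mul_add_div hd, Nat.div_eq_of_lt h1, add_zero]

lemma tn_inj (n d c e : ℕ) (hn : 0 < n) (hc : c < n * d) (he : e < n * d)
    (h : tn n d c = tn n d e) : c = e := by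
  obtain ⟨-, h1, h2⟩ := tn_spec n d c hn hc
  obtain ⟨-, h3, h4⟩ := tn_spec n d e hn he
  rw [← Nat.div_add_mod c n, ← Nat.div_add_mod e n, ← h1, ← h2, ← h3, ← h4, h]

lemma tn_add (n d c : ℕ) (hn : 0 < n) : tn n d (c + n) = tn n d c + 1 := by
  unfold tn
  rw [Nat.add_mod_right, Nat.add_div_right _ hn]
  omega

/-! ### The gluing row operation -/

open Classical in
lemma exists_glue {p n d : ℕ} (r : ℕ → ℕ) (hr : StrictMono r)
    (hrp : ∀ y < n * d, r y + 1 < p) (G : Pencil p (n * d))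
    (h1 : ∀ x y, G.1 x y = if (x : ℕ) = r y then 1 else 0)
    (h2 : ∀ x y, G.2 x y = if (x : ℕ) = r y + 1 then 1 else 0) :
    ∃ T : Matrix (Fin p) (Fin p) ℂ, IsUnit T ∧
      (∀ x y, (T * G.1) x y = if (x : ℕ) = r y then 1 else 0) ∧
      (∀ x y, (T * G.2) x y = if ((x : ℕ) = r y + 1 ∨
        ((y + 1 : ℕ) % d ≠ 0 ∧ (x : ℕ) = r (y + 1))) then 1 else 0) := by
  have hsucc : ∀ y z, r y + 1 = r z → z = y + 1 := by
    intro y z h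
    have a1 : y < z := hr.lt_iff_lt.1 (by omega)
    by_contra h3
    have a2 : r y < r (y+1) := hr (by omega)
    have a3 : r (y+1) < r z := hr (by omega)
    omega
  let N : Matrix (Fin p) (Fin p) ℂ := fun x s =>
    if ∃ y, (y + 1) % d ≠ 0 ∧ (s : ℕ) = r y + 1 ∧ (x : ℕ) = r (y + 1) ∧ x ≠ s then 1 else 0
  have hNr : ∀ x (s : Fin p) z, (s : ℕ) = r z → N x s = 0 := by
    intro x s z hs
    simp only [N]
    rw [if_neg]
    rintro ⟨y, -, b1, b2, b3⟩
    have := hsucc y z (by omega)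
    subst this
    exact b3 (Fin.ext (by omega))
  have hNN : N * N = 0 := by
    ext x s
    rw [Matrix.mul_apply, Matrix.zero_apply]
    refine Finset.sum_eq_zero fun w _ => ?_
    by_cases hw : ∃ y, (y + 1) % d ≠ 0 ∧ (s : ℕ) = r y + 1 ∧ (w : ℕ) = r (y + 1) ∧ w ≠ s
    · obtain ⟨y, -, -, b, -⟩ := hw
      rw [hNr x w _ b, zero_mul]
    · have : N w s = 0 := if_neg hw
      rw [this, mul_zero]
  refine ⟨1 + N, ?_, ?_, ?_⟩
  · refine IsUnit.of_mul_eq_one (1 - N) ?_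
    rw [Matrix.add_mul, Matrix.mul_sub, Matrix.mul_sub, hNN]
    simp
  · intro x y
    rw [Matrix.add_mul, Matrix.one_mul, Matrix.add_apply, h1, Matrix.mul_apply]
    rw [Finset.sum_eq_zero, add_zero]
    intro w _
    rw [h1]
    split_ifs with hw
    · rw [hNr x w _ hw, zero_mul]
    · rw [mul_zero]
  · intro x y
    have hb := hrp y y.2
    rw [Matrix.add_mul, Matrix.one_mul, Matrix.add_apply, h2, Matrix.mul_apply]
    rw [Finset.sum_eq_single (⟨r y + 1, hb⟩ : Fin p)]
    · rw [h2]
      have hN : N x ⟨r y + 1, hb⟩ =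
          if ((y + 1 : ℕ) % d ≠ 0 ∧ (x : ℕ) = r (y + 1) ∧ (x : ℕ) ≠ r y + 1) then 1 else 0 := by
        simp only [N]
        refine if_congr ⟨?_, ?_⟩ rfl rfl
        · rintro ⟨z, b1, b2, b3, b4⟩
          have : (y : ℕ) = z := hr.injective (by simpa using b2)
          subst this
          exact ⟨b1, b3, fun h => b4 (Fin.ext h)⟩
        · rintro ⟨b1, b3, b4⟩
          exact ⟨y, b1, rfl, b3, fun h => b4 (by rw [h])⟩
      rw [hN]
      by_cases c1 : (x : ℕ) = r y + 1 <;>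
        by_cases c2 : ((y + 1 : ℕ) % d ≠ 0 ∧ (x : ℕ) = r (y + 1)) <;> simp_all
    · intro w _ hw
      rw [h2, if_neg, mul_zero]
      intro h; exact hw (Fin.ext h)
    · intro h; exact absurd (Finset.mem_univ _) h

/-! ### The abstract construction -/

lemma exists_poly_of_path (m n d : ℕ) (hn : 1 ≤ n) (hd : 1 ≤ d)
    (r : ℕ → ℕ) (hr : StrictMono r)
    (hrp : ∀ y < n * d, r y + 1 < m + n * (d - 1)) (G : Pencil (m + n * (d-1)) (n * d))
    (h1 : ∀ x y, G.1 x y = if (x : ℕ) = r y then 1 else 0)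
    (h2 : ∀ x y, G.2 x y = if (x : ℕ) = r y + 1 then 1 else 0) :
    ∃ P : Pol d m n, P (Fin.last d) ≠ 0 ∧ nrank P = n ∧ StrictEquiv (comp m n d P) G := by
  classical
  obtain ⟨T, hT, hT1, hT2⟩ := exists_glue r hr hrp G h1 h2
  have hsucc : ∀ y z, r y + 1 = r z → z = y + 1 := by
    intro y z h
    have a1 : y < z := hr.lt_iff_lt.1 (by omega)
    by_contra h3
    have a2 : r y < r (y+1) := hr (by omega)
    have a3 : r (y+1) < r z := hr (by omega)
    omega
  have hnd : n * d = n * (d - 1) + n := by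
    obtain ⟨e, rfl⟩ := Nat.exists_eq_add_of_le hd
    rw [Nat.add_sub_cancel_left]; ring
  -- the column permutation
  obtain ⟨τ, hτ⟩ : ∃ τ : Fin (n*d) ≃ Fin (n*d), ∀ c, (τ c : ℕ) = tn n d c := by
    let f : Fin (n*d) → Fin (n*d) := fun c => ⟨tn n d c, (tn_spec n d c hn c.2).1⟩
    have hf : Function.Injective f := by
      intro a b hab
      exact Fin.ext (tn_inj n d a b hn a.2 b.2 (by simpa [f] using hab))
    exact ⟨Equiv.ofBijective f (Finite.injective_iff_bijective.1 hf), fun c => rfl⟩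
  -- the row permutation
  obtain ⟨σ, hσ⟩ : ∃ σ : Fin (m + n*(d-1)) ≃ Fin (m + n*(d-1)),
      ∀ i : Fin (m + n*(d-1)), m ≤ (i : ℕ) → (σ i : ℕ) = r (tn n d (i - m + n)) := by
    let f : Fin (m + n*(d-1)) → ℕ := fun i => r (tn n d (i - m + n))
    have hlt : ∀ i : Fin (m + n*(d-1)), m ≤ (i : ℕ) → (i : ℕ) - m + n < n * d := by
      intro i hi; have := i.2; omega
    have hmaps : Set.MapsTo f {i | m ≤ (i : ℕ)} (Finset.range (m + n*(d-1))) := by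
      intro i hi
      have := hrp _ (tn_spec n d _ hn (hlt i hi)).1
      simp only [f, Finset.coe_range, Set.mem_Iio]
      omega
    have hinj : Set.InjOn f {i | m ≤ (i : ℕ)} := by
      intro i hi j hj hij
      have := tn_inj n d _ _ hn (hlt i hi) (hlt j hj) (hr.injective hij)
      simp only [Set.mem_ofPred_eq] at hi hj
      exact Fin.ext (by omega)
    obtain ⟨g, hg⟩ := hmaps.exists_equiv_extend_of_card_eq (by simp) hinj
    let e : Finset.range (m + n*(d-1)) ≃ Fin (m + n*(d-1)) :=
      { toFun := fun x => ⟨x.1, Finset.mem_range.1 x.2⟩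
        invFun := fun x => ⟨x.1, Finset.mem_range.2 x.2⟩
        left_inv := fun x => rfl
        right_inv := fun x => rfl }
    exact ⟨g.trans e, fun i hi => hg i hi⟩
  let s : Fin (m + n*(d-1)) → ℂ := fun i =>
    if (i : ℕ) < m then 1 else (-1) ^ (((i : ℕ) - m + n) / n)
  let s' : Fin (n*d) → ℂ := fun c => (-1) ^ ((c : ℕ) / n)
  let C1 : Matrix (Fin (m + n*(d-1))) (Fin (n*d)) ℂ := fun i c =>
    s i * (T * G.1) (σ i) (τ c) * s' c
  let C2 : Matrix (Fin (m + n*(d-1))) (Fin (n*d)) ℂ := fun i c =>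
    s i * (T * G.2) (σ i) (τ c) * s' c
  have hnle : n ≤ n * d := Nat.le_mul_of_pos_right n hd
  let P : Pol d m n := fun k i j =>
    if k = Fin.last d then C1 ⟨i, by omega⟩ ⟨j, by omega⟩
    else if h : (d - 1 - k) * n + j < n * d then C2 ⟨i, by omega⟩ ⟨(d - 1 - k) * n + j, h⟩
    else 0
  have hsq : ∀ a : ℕ, ((-1 : ℂ)) ^ a * (-1) ^ a = 1 := by
    intro a; rw [← mul_pow]; norm_num
  have hA : compA m n d P = C1 := by
    ext i c
    unfold compA
    have hi2 := i.2
    have hc2 := c.2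
    split_ifs with hi hc hc
    · simp [P]
    · push Not at hc
      simp only [C1, hT1, hτ]
      rw [if_neg]
      · simp
      intro h
      have h3 := hσ ⟨c - n + m, by omega⟩ (by simp)
      have h4 : (c : ℕ) - n + m - m + n = c := by omega
      simp only [h4, ← h] at h3
      have h5 := congrArg Fin.val (σ.injective (Fin.ext h3))
      simp only at h5
      omega
    · push Not at hi
      have hce : (c : ℕ) = i - m + n := by omega
      simp only [C1, hT1, hτ, hσ i hi, s, s', ← hce, hi.not_gt, if_true, if_false, mul_one, hsq]
    · push Not at hi
      simp only [C1, hT1, hτ, hσ i hi]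
      rw [if_neg]
      · simp
      intro h
      have := tn_inj n d _ _ hn (by omega) c.2 (hr.injective h)
      omega
  have hB : compB m n d P = C2 := by
    ext i c
    unfold compB
    have hi2 := i.2
    have hc2 := c.2
    have hcd : (c : ℕ) / n < d := Nat.div_lt_of_lt_mul hc2
    have hdm := Nat.div_add_mod' (c : ℕ) n
    split_ifs with hi hn' hc
    · simp only [P]
      have e1 : d - 1 - (d - 1 - (c : ℕ) / n) = c / n := Nat.sub_sub_self (Nat.le_pred_of_lt hcd)
      rw [if_neg]
      · simp only [e1, hdm, hc2, dif_pos]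
      · intro h
        have := congrArg Fin.val h
        simp only [Fin.val_last] at this
        omega
    · exact absurd hn hn'
    · push Not at hi
      have hce : (i : ℕ) - m + n = c + n := by omega
      have e1 : ((c : ℕ) + n) / n = c / n + 1 := Nat.add_div_right _ hn
      have e2 : (tn n d c + 1) % d ≠ 0 := by
        rw [← tn_add n d c hn, (tn_spec n d (c + n) hn (by omega)).2.1, e1]
        exact Nat.succ_ne_zero _
      have e3 : (σ i : ℕ) = r (tn n d c + 1) := by
        rw [hσ i hi, hce, tn_add n d c hn]
      simp only [C2, hT2, hτ, s, s']
      rw [if_pos (Or.inr ⟨e2, e3⟩), if_neg hi.not_gt, hce, e1, pow_succ]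
      have := hsq ((c : ℕ) / n)
      linear_combination this
    · push Not at hi
      simp only [C2, hT2, hτ]
      rw [if_neg]
      · simp
      intro h
      have h3 : tn n d (i - m + n) = tn n d c + 1 := by
        rw [hσ i hi] at h
        rcases h with h | h
        · exact hsucc _ _ h.symm
        · exact hr.injective h.2
      rw [tn_add n d _ hn] at h3
      have := tn_inj n d _ _ hn (by omega) c.2 (Nat.succ_injective h3)
      omega
  have hunit : ∀ j, ∃ i, ∀ j', P (Fin.last d) i j' = if j' = j then 1 else 0 := by
    intro j
    have hj : (j : ℕ) < n * d := by omega
    have hb := hrp _ (tn_spec n d j hn hj).1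
    obtain ⟨i, hi⟩ := σ.surjective ⟨r (tn n d j), by omega⟩
    have hi' : (σ i : ℕ) = r (tn n d j) := by rw [hi]
    have him : (i : ℕ) < m := by
      by_contra h
      push Not at h
      have hi2 := i.2
      rw [hσ i h] at hi'
      have := tn_inj n d _ _ hn (by omega) hj (hr.injective hi')
      omega
    refine ⟨⟨i, him⟩, fun j' => ?_⟩
    have hjzero : (j' : ℕ) / n = 0 := Nat.div_eq_of_lt j'.2
    simp only [P, if_true, C1, hT1, hτ, s, s', Fin.eta, hi', him, hjzero, pow_zero, one_mul, mul_one]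
    refine if_congr ⟨fun h => ?_, fun h => by rw [h]⟩ rfl rfl
    exact Fin.ext (tn_inj n d _ _ hn hj (by omega) (hr.injective h)).symm
  refine ⟨P, ?_, nrank_eq P hunit, ?_⟩
  · intro h0
    obtain ⟨i, hi⟩ := hunit ⟨0, hn⟩
    have := hi ⟨0, hn⟩
    rw [h0] at this
    simp at this
  · refine strictEquiv_of_entries G (comp m n d P) T hT σ τ s s' ?_ ?_ ?_ ?_
    · intro i; simp only [s]; split_ifs <;> simp
    · intro i; simp [s']
    · intro i c; change compA m n d P i c = _; rw [hA]
    · intro i c; change compB m n d P i c = _; rw [hB]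

/-- Case `m > n`:  there is a polynomial of degree exactly `d` and
normal rank exactly `n` whose first companion form is strictly equivalent to `G_ℓp`. -/
theorem exists_poly_with_Glp_eigenstructure (m n d : ℕ) (hn : 1 ≤ n) (hnm : n < m)
    (hd : 1 ≤ d) :
    ∃ P : Pol d m n, P (Fin.last d) ≠ 0 ∧ nrank P = n ∧
      StrictEquiv (comp m n d P) (Glp m n d) := by
  obtain ⟨h1, h2⟩ := Glp_entries m n d hnm
  have ht : n*d % (m-n) < m - n := Nat.mod_lt _ (by omega)
  have hq : (m-n) * (n*d/(m-n)) + n*d % (m-n) = n * d := Nat.div_add_mod _ _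
  have hnd : n * d = n * (d - 1) + n := by
    obtain ⟨e, rfl⟩ := Nat.exists_eq_add_of_le hd
    rw [Nat.add_sub_cancel_left]; ring
  refine exists_poly_of_path m n d hn hd _ (rl_lt (n*d/(m-n)) (n*d % (m-n))) ?_ _ h1 h2
  intro y hy
  have := rl_bound (n*d/(m-n)) (n*d % (m-n)) (m-n) y ht.le (by rw [hq]; exact hy)
  rw [hq] at this
  omega

end MPoly
end
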